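/- arXiv:2502.13868 — 5 statements merged into one kernel-verified Lean document; each statement's English description precedes it below -/
import Mathlib

section
/- Let n ≥ 2, let Z be a set, let z_1, …, z_n be elements of Z, and let f : Z × Z → ℝ be symmetric (f(u,v) = f(v,u) for all u,v). Then the U-statistic average equals the average over all permutations of sums of disjoint blocks: C(n,2)^{-1} · Σ_{1 ≤ i < j ≤ n} f(z_i, z_j) = (1/n!) · Σ_{σ ∈ S_n} ⌊n/2⌋^{-1} · Σ_{i=1}^{⌊n/2⌋} f(z_{σ(i)}, z_{σ(⌊n/2⌋ + i)}), where S_n is the set of all permutations of {1,…,n} and C(n,2) = n(n−1)/2. -/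
open Finset

lemma exists_perm_pair {n : ℕ} {a b c d : Fin n} (hab : a ≠ b) (hcd : c ≠ d) :
    ∃ π : Equiv.Perm (Fin n), π a = c ∧ π b = d := by
  have h : Equiv.swap a c b ≠ c := by
    intro h
    apply hab
    apply (Equiv.swap a c).injective
    rw [h, Equiv.swap_apply_left]
  refine ⟨(Equiv.swap a c).trans (Equiv.swap (Equiv.swap a c b) d), ?_, ?_⟩
  · rw [Equiv.trans_apply, Equiv.swap_apply_left, Equiv.swap_apply_of_ne_of_ne h.symm hcd]
  · rw [Equiv.trans_apply, Equiv.swap_apply_left]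

lemma perm_sum_eq {n : ℕ} (g : Fin n → Fin n → ℝ) {a b c d : Fin n}
    (hab : a ≠ b) (hcd : c ≠ d) :
    ∑ σ : Equiv.Perm (Fin n), g (σ c) (σ d) = ∑ σ : Equiv.Perm (Fin n), g (σ a) (σ b) := by
  obtain ⟨π, rfl, rfl⟩ := exists_perm_pair hab hcd
  exact Fintype.sum_equiv (Equiv.mulRight π) _ _ (fun σ => by simp)

lemma perm_sum_offDiag {n : ℕ} (g : Fin n → Fin n → ℝ) (σ : Equiv.Perm (Fin n)) :
    ∑ p ∈ (univ : Finset (Fin n)).offDiag, g (σ p.1) (σ p.2)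
      = ∑ p ∈ (univ : Finset (Fin n)).offDiag, g p.1 p.2 :=
  Finset.sum_equiv (Equiv.prodCongr σ σ) (by simp) (by simp)

lemma offDiag_eq_two_mul {n : ℕ} (g : Fin n → Fin n → ℝ) (hg : ∀ i j, g i j = g j i) :
    ∑ p ∈ (univ : Finset (Fin n)).offDiag, g p.1 p.2
      = 2 * ∑ p ∈ univ.filter (fun p : Fin n × Fin n => p.1 < p.2), g p.1 p.2 := by
  have h1 : (univ : Finset (Fin n)).offDiag
      = univ.filter (fun p : Fin n × Fin n => p.1 < p.2)
        ∪ univ.filter (fun p : Fin n × Fin n => p.2 < p.1) := by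
    ext p
    simp [lt_or_lt_iff_ne]
  have h2 : Disjoint (univ.filter (fun p : Fin n × Fin n => p.1 < p.2))
      (univ.filter (fun p : Fin n × Fin n => p.2 < p.1)) := by
    rw [Finset.disjoint_filter]
    intro p _ h h'
    exact lt_asymm h h'
  have h3 : ∑ p ∈ univ.filter (fun p : Fin n × Fin n => p.2 < p.1), g p.1 p.2
      = ∑ p ∈ univ.filter (fun p : Fin n × Fin n => p.1 < p.2), g p.1 p.2 :=
    Finset.sum_equiv (Equiv.prodComm _ _) (by simp) (fun p _ => hg _ _)
  rw [h1, Finset.sum_union h2, h3]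
  ring

lemma perm_sum_value {n : ℕ} (g : Fin n → Fin n → ℝ) (hg : ∀ i j, g i j = g j i)
    {a b : Fin n} (hab : a ≠ b) :
    ((n : ℝ) * (n - 1)) * ∑ σ : Equiv.Perm (Fin n), g (σ a) (σ b)
      = n.factorial *
        (2 * ∑ p ∈ univ.filter (fun p : Fin n × Fin n => p.1 < p.2), g p.1 p.2) := by
  have h1 : ∑ p ∈ (univ : Finset (Fin n)).offDiag,
      ∑ σ : Equiv.Perm (Fin n), g (σ p.1) (σ p.2)
      = ((n : ℝ) * (n - 1)) * ∑ σ : Equiv.Perm (Fin n), g (σ a) (σ b) := by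
    rw [Finset.sum_congr rfl (fun p hp => perm_sum_eq g hab (Finset.mem_offDiag.1 hp).2.2),
      Finset.sum_const, Finset.offDiag_card, nsmul_eq_mul, Finset.card_univ, Fintype.card_fin,
      Nat.cast_sub (Nat.le_mul_self n)]
    push_cast
    ring
  rw [← h1, Finset.sum_comm, Finset.sum_congr rfl (fun σ _ => perm_sum_offDiag g σ),
    Finset.sum_const, Finset.card_univ, Fintype.card_perm, Fintype.card_fin, nsmul_eq_mul,
    offDiag_eq_two_mul g hg]

/-- **Hoeffding's representation of a U-statistic of order two.**
For `n ≥ 2`, points `z_1, …, z_n` in a set `Z` and a symmetric kernel `f`,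
the U-statistic average equals the average over all permutations of the average of
`⌊n/2⌋` terms built from disjoint index pairs. -/
theorem hoeffding_representation {Z : Type*} (n : ℕ) (hn : 2 ≤ n)
    (z : Fin n → Z) (f : Z → Z → ℝ) (hf : ∀ u v, f u v = f v u) :
    ((n.choose 2 : ℝ))⁻¹ *
        ∑ p ∈ Finset.univ.filter (fun p : Fin n × Fin n => p.1 < p.2), f (z p.1) (z p.2)
      = ((n.factorial : ℝ))⁻¹ *
          ∑ σ : Equiv.Perm (Fin n),
            ((n / 2 : ℕ) : ℝ)⁻¹ *
              ∑ i : Fin (n / 2),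
                f (z (σ ⟨i.val, by have := i.isLt; omega⟩))
                  (z (σ ⟨n / 2 + i.val, by have := i.isLt; omega⟩)) := by
  have hm : ((n / 2 : ℕ) : ℝ) ≠ 0 := by
    have : n / 2 ≠ 0 := by omega
    exact_mod_cast this
  have hn2 : (2 : ℝ) ≤ n := by exact_mod_cast hn
  have hn0 : (n : ℝ) ≠ 0 := by linarith
  have hn1 : (n : ℝ) - 1 ≠ 0 := by linarith
  have hfac : (n.factorial : ℝ) ≠ 0 := by exact_mod_cast n.factorial_ne_zero
  set S := ∑ p ∈ Finset.univ.filter (fun p : Fin n × Fin n => p.1 < p.2), f (z p.1) (z p.2)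
    with hS
  rw [← Finset.mul_sum, Finset.sum_comm]
  have key : ∀ i : Fin (n / 2), ∑ σ : Equiv.Perm (Fin n),
      f (z (σ ⟨i.val, by have := i.isLt; omega⟩))
        (z (σ ⟨n / 2 + i.val, by have := i.isLt; omega⟩))
      = n.factorial * (2 * S) / ((n : ℝ) * (n - 1)) := by
    intro i
    rw [eq_div_iff (mul_ne_zero hn0 hn1), mul_comm]
    refine perm_sum_value (fun i j => f (z i) (z j)) (fun _ _ => hf _ _) ?_
    intro h
    have := congrArg Fin.val h
    simp only at this
    omega
  rw [Finset.sum_congr rfl (fun i _ => key i), Finset.sum_const, Finset.card_univ,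
    Fintype.card_fin, nsmul_eq_mul, Nat.cast_choose_two]
  field_simp
end

section
/- Under the unconfoundedness setup, let f : ℝ × 𝒳 → ℝ be bounded measurable and let φ₁ : 𝒳 → ℝ be any measurable function satisfying φ₁(X)·e(X) = E[D·f(Y, X) | σ(X)] almost surely. Then for any measurable policy π : 𝒳 → {0,1}: E[f(Y(1), X)·π(X)] = E[φ₁(X)·π(X)]. Analogously, if φ₀ : 𝒳 → ℝ satisfies φ₀(X)·(1 − e(X)) = E[(1 − D)·f(Y, X) | σ(X)] almost surely, then E[f(Y(0), X)·(1 − π(X))] = E[φ₀(X)·(1 − π(X))]. -/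
open MeasureTheory ProbabilityTheory

/-- Integrability of bounded measurable functions. -/
lemma dm_integrable {Ω : Type*} [MeasurableSpace Ω] (μ : Measure Ω) [IsProbabilityMeasure μ]
    {g : Ω → ℝ} (hg : Measurable g) {C : ℝ} (hC : ∀ ω, |g ω| ≤ C) : Integrable g μ :=
  Integrable.of_bound hg.aestronglyMeasurable C (Filter.Eventually.of_forall hC)

lemma dm_rect {Ω 𝒳 : Type*} [MeasurableSpace Ω] [StandardBorelSpace Ω] [Nonempty Ω]
    [MeasurableSpace 𝒳]
    (μ : Measure Ω) [IsProbabilityMeasure μ]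
    (Z W : Ω → ℝ) (hZ : Measurable Z) (hW : Measurable W) (hWbin : ∀ ω, W ω = 0 ∨ W ω = 1)
    (X : Ω → 𝒳) (hX : Measurable X)
    (hCI : CondIndepFun (MeasurableSpace.comap X inferInstance) hX.comap_le Z W μ)
    (w : 𝒳 → ℝ) (hw : Measurable w) (hwb : ∀ x, |w x| ≤ 1)
    (hcond : (fun ω => w (X ω)) =ᵐ[μ] μ[W | MeasurableSpace.comap X inferInstance])
    (A : Set ℝ) (hA : MeasurableSet A) (B : Set 𝒳) (hB : MeasurableSet B) :
    ∫ ω in X ⁻¹' B ∩ Z ⁻¹' A, W ω ∂μ = ∫ ω in X ⁻¹' B ∩ Z ⁻¹' A, w (X ω) ∂μ := by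
  have hS : MeasurableSet (Z ⁻¹' A) := hZ hA
  have hT : MeasurableSet (X ⁻¹' B) := hX hB
  have hTm : MeasurableSet[MeasurableSpace.comap X inferInstance] (X ⁻¹' B) := ⟨B, hB, rfl⟩
  have hW1 : (W ⁻¹' {1}).indicator (fun _ => (1 : ℝ)) = W := by
    ext ω
    by_cases h : W ω = 1
    · simp [Set.indicator, h]
    · have := (hWbin ω).resolve_right h
      simp [Set.indicator, this]
  have hSW : (Z ⁻¹' A ∩ W ⁻¹' {1}).indicator (fun _ => (1 : ℝ)) = (Z ⁻¹' A).indicator W := by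
    rw [← Set.indicator_indicator, hW1]
  have key := (condIndepFun_iff_condExp_inter_preimage_eq_mul hZ hW).1 hCI A {1} hA
    (measurableSet_singleton 1)
  rw [hW1, hSW] at key
  have hWi : Integrable W μ := dm_integrable μ hW (C := 1) (fun ω => by
    rcases hWbin ω with h | h <;> simp [h])
  have hwi : Integrable (fun ω => w (X ω)) μ :=
    dm_integrable μ (hw.comp hX) (C := 1) (fun ω => hwb _)
  have h1i : Integrable ((Z ⁻¹' A).indicator (fun _ => (1 : ℝ))) μ :=
    (integrable_const 1).indicator hS
  have hmul : (Z ⁻¹' A).indicator (fun _ => (1 : ℝ)) * (fun ω => w (X ω))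
      = (Z ⁻¹' A).indicator (fun ω => w (X ω)) := by
    ext ω
    by_cases h : ω ∈ Z ⁻¹' A <;> simp [Set.indicator, h]
  have hwm : StronglyMeasurable[MeasurableSpace.comap X inferInstance] (fun ω => w (X ω)) :=
    (hw.comp (comap_measurable X)).stronglyMeasurable
  have pull := condExp_mul_of_stronglyMeasurable_right (μ := μ) hwm
    (f := (Z ⁻¹' A).indicator (fun _ => (1 : ℝ)))
    (by rw [hmul]; exact hwi.indicator hS) h1i
  rw [hmul] at pull
  rw [← setIntegral_indicator hS, ← setIntegral_indicator hS,
    ← setIntegral_condExp hX.comap_le (hWi.indicator hS) hTm,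
    ← setIntegral_condExp hX.comap_le (hwi.indicator hS) hTm]
  refine setIntegral_congr_ae hT ?_
  filter_upwards [key, pull, hcond] with ω h1 h2 h3 _
  rw [h1, h2, ← h3]
  rfl

lemma dm_swap {Ω 𝒳 : Type*} [MeasurableSpace Ω] [StandardBorelSpace Ω] [Nonempty Ω]
    [MeasurableSpace 𝒳]
    (μ : Measure Ω) [IsProbabilityMeasure μ]
    (Z W : Ω → ℝ) (hZ : Measurable Z) (hW : Measurable W) (hWbin : ∀ ω, W ω = 0 ∨ W ω = 1)
    (X : Ω → 𝒳) (hX : Measurable X)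
    (hCI : CondIndepFun (MeasurableSpace.comap X inferInstance) hX.comap_le Z W μ)
    (w : 𝒳 → ℝ) (hw : Measurable w) (hwn : ∀ x, 0 ≤ w x) (hwb : ∀ x, w x ≤ 1)
    (hcond : (fun ω => w (X ω)) =ᵐ[μ] μ[W | MeasurableSpace.comap X inferInstance])
    (h : ℝ × 𝒳 → ℝ) (hh : Measurable h) :
    ∫ ω, W ω * h (Z ω, X ω) ∂μ = ∫ ω, w (X ω) * h (Z ω, X ω) ∂μ := by
  have hwab : ∀ x, |w x| ≤ 1 := fun x => by rw [abs_of_nonneg (hwn x)]; exact hwb x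
  have hWn : ∀ ω, 0 ≤ W ω := fun ω => by rcases hWbin ω with h | h <;> simp [h]
  have hWi : Integrable W μ := dm_integrable μ hW (C := 1) (fun ω => by
    rcases hWbin ω with h | h <;> simp [h])
  have hwi : Integrable (fun ω => w (X ω)) μ :=
    dm_integrable μ (hw.comp hX) (C := 1) (fun ω => hwab _)
  have hP : Measurable (fun ω => (Z ω, X ω)) := hZ.prodMk hX
  have hf1 : IsFiniteMeasure (μ.withDensity fun ω => ENNReal.ofReal (W ω)) :=
    isFiniteMeasure_withDensity_ofReal hWi.2
  have hf2 : IsFiniteMeasure (μ.withDensity fun ω => ENNReal.ofReal (w (X ω))) :=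
    isFiniteMeasure_withDensity_ofReal hwi.2
  have hmeas : (μ.withDensity fun ω => ENNReal.ofReal (W ω)).map (fun ω => (Z ω, X ω))
      = (μ.withDensity fun ω => ENNReal.ofReal (w (X ω))).map (fun ω => (Z ω, X ω)) := by
    refine Measure.ext_prod (fun {A B} hA hB => ?_)
    have hpre : (fun ω => (Z ω, X ω)) ⁻¹' (A ×ˢ B) = X ⁻¹' B ∩ Z ⁻¹' A := by
      ext ω; simp [and_comm]
    have hms : MeasurableSet (X ⁻¹' B ∩ Z ⁻¹' A) := (hX hB).inter (hZ hA)
    rw [Measure.map_apply hP (hA.prod hB), Measure.map_apply hP (hA.prod hB), hpre,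
      withDensity_apply _ hms, withDensity_apply _ hms,
      ← ofReal_integral_eq_lintegral_ofReal hWi.integrableOn (Filter.Eventually.of_forall hWn),
      ← ofReal_integral_eq_lintegral_ofReal hwi.integrableOn
        (Filter.Eventually.of_forall fun ω => hwn _),
      dm_rect μ Z W hZ hW hWbin X hX hCI w hw hwab hcond A hA B hB]
  have := congrArg (fun ν => ∫ p, h p ∂ν) hmeas
  rw [integral_map hP.aemeasurable hh.aestronglyMeasurable,
    integral_map hP.aemeasurable hh.aestronglyMeasurable,
    integral_withDensity_eq_integral_toReal_smul hW.ennreal_ofReal (by simp),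
    integral_withDensity_eq_integral_toReal_smul (f := fun ω => ENNReal.ofReal (w (X ω))) (hw.comp hX).ennreal_ofReal (by simp)] at this
  simpa only [ENNReal.toReal_ofReal (hWn _), ENNReal.toReal_ofReal (hwn _), smul_eq_mul] using this

lemma dm_arm {Ω 𝒳 : Type*} [MeasurableSpace Ω] [StandardBorelSpace Ω] [Nonempty Ω]
    [MeasurableSpace 𝒳]
    (μ : Measure Ω) [IsProbabilityMeasure μ]
    (Z W : Ω → ℝ) (hZ : Measurable Z) (hW : Measurable W) (hWbin : ∀ ω, W ω = 0 ∨ W ω = 1)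
    (X : Ω → 𝒳) (hX : Measurable X)
    (hCI : CondIndepFun (MeasurableSpace.comap X inferInstance) hX.comap_le Z W μ)
    (w : 𝒳 → ℝ) (hw : Measurable w) (κ : ℝ) (hκ : 0 < κ) (hwκ : ∀ x, κ ≤ w x)
    (hwb : ∀ x, w x ≤ 1)
    (hcond : (fun ω => w (X ω)) =ᵐ[μ] μ[W | MeasurableSpace.comap X inferInstance])
    (f : ℝ × 𝒳 → ℝ) (hf : Measurable f) (hfb : ∃ C, ∀ p, |f p| ≤ C)
    (p : 𝒳 → ℝ) (hp : Measurable p) (hpbin : ∀ x, p x = 0 ∨ p x = 1)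
    (φ : 𝒳 → ℝ)
    (hφ : (fun ω => φ (X ω) * w (X ω))
      =ᵐ[μ] μ[(fun ω => W ω * f (Z ω, X ω)) | MeasurableSpace.comap X inferInstance]) :
    ∫ ω, f (Z ω, X ω) * p (X ω) ∂μ = ∫ ω, φ (X ω) * p (X ω) ∂μ := by
  obtain ⟨C, hC⟩ := hfb
  have hwpos : ∀ x, 0 < w x := fun x => hκ.trans_le (hwκ x)
  have hP : Measurable (fun ω => (Z ω, X ω)) := hZ.prodMk hX
  have hWab : ∀ ω, |W ω| ≤ 1 := fun ω => by rcases hWbin ω with h | h <;> simp [h]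
  have hq : Measurable (fun x => p x / w x) := hp.div hw
  have hqb : ∀ x, |p x / w x| ≤ 1 / κ := fun x => by
    rw [abs_div, abs_of_pos (hwpos x)]
    have : |p x| ≤ 1 := by rcases hpbin x with h | h <;> simp [h]
    exact div_le_div₀ zero_le_one this hκ (hwκ x)
  have hWf : ∀ ω, |W ω * f (Z ω, X ω)| ≤ C := fun ω => by
    have h1 := hC (Z ω, X ω)
    have h0 := (abs_nonneg _).trans h1
    rcases hWbin ω with h | h <;> simp [h, h0, h1]
  have hC0 : 0 ≤ C := (abs_nonneg _).trans (hWf (Classical.arbitrary Ω))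
  have hWfm : Measurable (fun ω => W ω * f (Z ω, X ω)) := hW.mul (hf.comp hP)
  have hWfi : Integrable (fun ω => W ω * f (Z ω, X ω)) μ := dm_integrable μ hWfm hWf
  have hprod : Integrable ((fun ω => W ω * f (Z ω, X ω)) * fun ω => p (X ω) / w (X ω)) μ := by
    refine dm_integrable μ (hWfm.mul (hq.comp hX)) (C := C * (1 / κ)) fun ω => ?_
    simp only [Pi.mul_apply, Function.comp]
    rw [abs_mul]
    exact mul_le_mul (hWf ω) (hqb _) (abs_nonneg _) hC0
  have hqm : StronglyMeasurable[MeasurableSpace.comap X inferInstance]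
      (fun ω => p (X ω) / w (X ω)) :=
    (hq.comp (comap_measurable X)).stronglyMeasurable
  have pull := condExp_mul_of_stronglyMeasurable_right hqm hprod hWfi
  calc ∫ ω, f (Z ω, X ω) * p (X ω) ∂μ
      = ∫ ω, w (X ω) * (f (Z ω, X ω) * (p (X ω) / w (X ω))) ∂μ := by
        refine integral_congr_ae (Filter.Eventually.of_forall fun ω => ?_)
        have := (hwpos (X ω)).ne'
        simp only
        field_simp
    _ = ∫ ω, W ω * (f (Z ω, X ω) * (p (X ω) / w (X ω))) ∂μ :=
        (dm_swap μ Z W hZ hW hWbin X hX hCI w hw (fun x => (hwpos x).le) hwb hcond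
          (fun q => f q * (p q.2 / w q.2)) (hf.mul (hq.comp measurable_snd))).symm
    _ = ∫ ω, ((fun ω => W ω * f (Z ω, X ω)) * fun ω => p (X ω) / w (X ω)) ω ∂μ := by
        simp only [Pi.mul_apply, mul_assoc]
    _ = ∫ ω, (μ[((fun ω => W ω * f (Z ω, X ω)) * fun ω => p (X ω) / w (X ω)) |
          MeasurableSpace.comap X inferInstance]) ω ∂μ := (integral_condExp hX.comap_le).symm
    _ = ∫ ω, φ (X ω) * p (X ω) ∂μ := by
        refine integral_congr_ae ?_
        filter_upwards [pull, hφ] with ω h1 h2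
        rw [h1, Pi.mul_apply, ← h2]
        have := (hwpos (X ω)).ne'
        field_simp

/-- **Direct-method identification of policy welfare under unconfoundedness.**
If `φ₁` satisfies `φ₁(X)·e(X) = E[D·f(Y,X) | σ(X)]` a.s., then
`E[f(Y(1),X)π(X)] = E[φ₁(X)π(X)]`; analogously for `φ₀` and the untreated arm. -/
theorem dm_identification {Ω 𝒳 : Type*} [MeasurableSpace Ω] [StandardBorelSpace Ω] [Nonempty Ω]
    [MeasurableSpace 𝒳] [StandardBorelSpace 𝒳]
    (μ : Measure Ω) [IsProbabilityMeasure μ]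
    (Y1 Y0 : Ω → ℝ) (hY1 : Measurable Y1) (hY0 : Measurable Y0)
    (hY1b : ∃ C, ∀ ω, |Y1 ω| ≤ C) (hY0b : ∃ C, ∀ ω, |Y0 ω| ≤ C)
    (D : Ω → ℝ) (hD : Measurable D) (hDbin : ∀ ω, D ω = 0 ∨ D ω = 1)
    (X : Ω → 𝒳) (hX : Measurable X)
    -- (i) unconfoundedness: (Y(1), Y(0)) ⫫ D | σ(X)
    (hCI : CondIndepFun (MeasurableSpace.comap X inferInstance) hX.comap_le
      (fun ω => (Y1 ω, Y0 ω)) D μ)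
    -- (ii) propensity score and overlap
    (e : 𝒳 → ℝ) (he : Measurable e)
    (hecond : (fun ω => e (X ω)) =ᵐ[μ] μ[D | MeasurableSpace.comap X inferInstance])
    (κ : ℝ) (hκpos : 0 < κ) (hκhalf : κ ≤ 1 / 2)
    (hoverlap : ∀ x, κ ≤ e x ∧ e x ≤ 1 - κ)
    -- observed outcome
    (Y : Ω → ℝ) (hYobs : ∀ ω, Y ω = D ω * Y1 ω + (1 - D ω) * Y0 ω)
    (f : ℝ × 𝒳 → ℝ) (hf : Measurable f) (hfb : ∃ C, ∀ p, |f p| ≤ C)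
    (π : 𝒳 → ℝ) (hπ : Measurable π) (hπbin : ∀ x, π x = 0 ∨ π x = 1)
    (φ₁ φ₀ : 𝒳 → ℝ) (hφ₁m : Measurable φ₁) (hφ₀m : Measurable φ₀) :
    (((fun ω => φ₁ (X ω) * e (X ω))
        =ᵐ[μ] μ[(fun ω => D ω * f (Y ω, X ω)) | MeasurableSpace.comap X inferInstance]) →
      (∫ ω, f (Y1 ω, X ω) * π (X ω) ∂μ) = ∫ ω, φ₁ (X ω) * π (X ω) ∂μ)
    ∧ (((fun ω => φ₀ (X ω) * (1 - e (X ω)))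
        =ᵐ[μ] μ[(fun ω => (1 - D ω) * f (Y ω, X ω)) | MeasurableSpace.comap X inferInstance]) →
      (∫ ω, f (Y0 ω, X ω) * (1 - π (X ω)) ∂μ)
        = ∫ ω, φ₀ (X ω) * (1 - π (X ω)) ∂μ) := by
  constructor
  · intro hφ
    have hfun : (fun ω => D ω * f (Y ω, X ω)) = fun ω => D ω * f (Y1 ω, X ω) := by
      ext ω
      rcases hDbin ω with h | h <;> simp [h, hYobs]
    rw [hfun] at hφ
    exact dm_arm μ Y1 D hY1 hD hDbin X hX (hCI.comp measurable_fst measurable_id) e he κ hκpos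
      (fun x => (hoverlap x).1) (fun x => by linarith [(hoverlap x).2]) hecond f hf hfb π hπ hπbin
      φ₁ hφ
  · intro hφ
    have hfun : (fun ω => (1 - D ω) * f (Y ω, X ω)) = fun ω => (1 - D ω) * f (Y0 ω, X ω) := by
      ext ω
      rcases hDbin ω with h | h <;> simp [h, hYobs]
    rw [hfun] at hφ
    have hDi : Integrable D μ := dm_integrable μ hD (C := 1) (fun ω => by
      rcases hDbin ω with h | h <;> simp [h])
    have hc : (fun ω => 1 - e (X ω)) =ᵐ[μ]
        μ[(fun ω => 1 - D ω) | MeasurableSpace.comap X inferInstance] := by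
      have h1 := condExp_sub (μ := μ) (integrable_const (1 : ℝ)) hDi
        (MeasurableSpace.comap X inferInstance)
      rw [condExp_const hX.comap_le] at h1
      filter_upwards [h1, hecond] with ω h2 h3
      rw [h3]
      exact h2.symm
    exact dm_arm μ Y0 (fun ω => 1 - D ω) hY0 (measurable_const.sub hD)
      (fun ω => by rcases hDbin ω with h | h <;> simp [h]) X hX
      (hCI.comp measurable_snd (measurable_const.sub measurable_id : Measurable fun x : ℝ => 1 - x))
      (fun x => 1 - e x) (measurable_const.sub he) κ hκpos
      (fun x => by linarith [(hoverlap x).2]) (fun x => by linarith [(hoverlap x).1]) hc f hf hfb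
      (fun x => 1 - π x) (measurable_const.sub hπ)
      (fun x => by rcases hπbin x with h | h <;> simp [h]) φ₀ hφ
end

section
/- Under the unconfoundedness setup, let (Y'(1), Y'(0), D', X') be an independent copy of (Y(1), Y(0), D, X) with Y' = D'·Y'(1) + (1 − D')·Y'(0). Then for every (a,b) ∈ {0,1}², every bounded measurable g : ℝ × 𝒳 × ℝ × 𝒳 → ℝ and every measurable function π_ab : 𝒳 × 𝒳 → {0,1}: E[g(Y(a), X, Y'(b), X')·π_ab(X, X')] = E[ g(Y, X, Y', X') · 1{D = a}·1{D' = b} · π_ab(X, X') / (e_a(X)·e_b(X')) ], where e_1 = e and e_0 = 1 − e. -/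
open MeasureTheory ProbabilityTheory

lemma ipw_core {Ω 𝒳 : Type*} [mΩ : MeasurableSpace Ω] [m𝒳 : MeasurableSpace 𝒳]
    (μ : Measure Ω) [IsProbabilityMeasure μ] (Z : Ω → ℝ) (hZ : Measurable Z)
    (X : Ω → 𝒳) (hX : Measurable X) (T : Set Ω) (hT : MeasurableSet T)
    (q : 𝒳 → ℝ) (hq : Measurable q) (κ : ℝ) (hκ : 0 < κ) (hqκ : ∀ x, κ ≤ q x)
    (hqT : (fun ω => q (X ω)) =ᵐ[μ] μ⟦T | m𝒳.comap X⟧)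
    (hCI : ∀ A, MeasurableSet A → μ⟦Z ⁻¹' A ∩ T | m𝒳.comap X⟧ =ᵐ[μ]
      fun ω => (μ⟦Z ⁻¹' A | m𝒳.comap X⟧) ω * (μ⟦T | m𝒳.comap X⟧) ω)
    (h : ℝ × 𝒳 → ℝ) (hh : Measurable h) :
    ∫ ω, h (Z ω, X ω) * (T.indicator (fun _ => (1 : ℝ)) ω / q (X ω)) ∂μ
      = ∫ ω, h (Z ω, X ω) ∂μ := by
  have hqpos : ∀ x, 0 < q x := fun x => hκ.trans_le (hqκ x)
  set w : Ω → ℝ := fun ω => T.indicator (fun _ => (1 : ℝ)) ω / q (X ω) with hw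
  have hT1 : Measurable (T.indicator (fun _ => (1 : ℝ))) := measurable_const.indicator hT
  have hwm : Measurable w := hT1.div (hq.comp hX)
  have hw0 : ∀ ω, 0 ≤ w ω := fun ω =>
    div_nonneg (Set.indicator_nonneg (fun _ _ => zero_le_one) ω) (hqpos _).le
  have hZX : Measurable (fun ω => (Z ω, X ω)) := hZ.prodMk hX
  set μ2 := μ.withDensity (fun ω => ENNReal.ofReal (w ω)) with hμ2
  have hwb : ∀ ω, ‖w ω‖ ≤ 1 / κ := by
    intro ω
    rw [Real.norm_of_nonneg (hw0 ω)]
    apply div_le_div₀ zero_le_one _ hκ (hqκ _)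
    by_cases hω : ω ∈ T <;> simp [hω]
  have hwint : Integrable w μ :=
    Integrable.of_bound hwm.aestronglyMeasurable (1 / κ) (ae_of_all _ hwb)
  have key : μ.map (fun ω => (Z ω, X ω)) = μ2.map (fun ω => (Z ω, X ω)) := by
    have : IsFiniteMeasure (μ.map (fun ω => (Z ω, X ω))) := inferInstance
    refine Measure.ext_prod fun {s t} hs ht => ?_
    rw [Measure.map_apply hZX (hs.prod ht), Measure.map_apply hZX (hs.prod ht)]
    have hpre : (fun ω => (Z ω, X ω)) ⁻¹' s ×ˢ t = Z ⁻¹' s ∩ X ⁻¹' t := by ext; simp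
    have hms : MeasurableSet (Z ⁻¹' s) := hZ hs
    have hmt : MeasurableSet (X ⁻¹' t) := hX ht
    have hmtX : MeasurableSet[m𝒳.comap X] (X ⁻¹' t) := ⟨t, ht, rfl⟩
    rw [hpre, hμ2, withDensity_apply _ (hms.inter hmt),
      ← ofReal_integral_eq_lintegral_ofReal hwint.integrableOn (ae_of_all _ hw0),
      ← ofReal_measureReal (measure_ne_top _ _)]
    congr 1
    have e1 : μ.real (Z ⁻¹' s ∩ X ⁻¹' t)
        = ∫ ω in X ⁻¹' t, (μ⟦Z ⁻¹' s | m𝒳.comap X⟧) ω ∂μ := by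
      rw [setIntegral_condExp hX.comap_le ((integrable_const _).indicator hms) hmtX,
        setIntegral_indicator hms, Set.inter_comm]
      simp
    have e2 : ∫ ω in Z ⁻¹' s ∩ X ⁻¹' t, w ω ∂μ
        = ∫ ω in X ⁻¹' t, ((fun ω => (q (X ω))⁻¹) *
            (Z ⁻¹' s ∩ T).indicator (fun _ => (1 : ℝ))) ω ∂μ := by
      rw [Set.inter_comm, ← setIntegral_indicator hms]
      congr 1
      ext ω
      by_cases h1 : Z ω ∈ s <;> by_cases h2 : ω ∈ T <;>
        simp [hw, Set.indicator, h1, h2]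
    have hqi : StronglyMeasurable[m𝒳.comap X] (fun ω => (q (X ω))⁻¹) :=
      (Measurable.stronglyMeasurable
        ((hq.inv).comp (comap_measurable X)))
    have hqib : ∀ ω, ‖(q (X ω))⁻¹‖ ≤ κ⁻¹ := fun ω => by
      rw [Real.norm_of_nonneg (inv_nonneg.2 (hqpos _).le)]
      exact inv_anti₀ hκ (hqκ _)
    have hind : Integrable ((Z ⁻¹' s ∩ T).indicator (fun _ => (1 : ℝ))) μ :=
      (integrable_const _).indicator (hms.inter hT)
    have hmulint : Integrable ((fun ω => (q (X ω))⁻¹) *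
            (Z ⁻¹' s ∩ T).indicator (fun _ => (1 : ℝ))) μ :=
      hind.bdd_mul (hqi.mono hX.comap_le).aestronglyMeasurable (ae_of_all _ hqib)
    rw [e1, e2, ← setIntegral_condExp hX.comap_le hmulint hmtX]
    apply integral_congr_ae
    apply ae_restrict_of_ae
    filter_upwards [condExp_stronglyMeasurable_mul_of_bound hX.comap_le hqi hind _
      (ae_of_all _ hqib), hCI s hs, hqT] with ω h1 h2 h3
    rw [h1, Pi.mul_apply, h2, ← h3]
    field_simp [(hqpos (X ω)).ne']
  have i1 : ∫ ω, h (Z ω, X ω) ∂μ = ∫ p, h p ∂(μ.map (fun ω => (Z ω, X ω))) :=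
    (integral_map hZX.aemeasurable hh.aestronglyMeasurable).symm
  rw [i1, key, integral_map hZX.aemeasurable hh.aestronglyMeasurable, hμ2,
    integral_withDensity_eq_integral_toReal_smul hwm.ennreal_ofReal
      (ae_of_all _ fun _ => ENNReal.ofReal_lt_top)]
  congr 1
  ext ω
  rw [ENNReal.toReal_ofReal (hw0 ω), smul_eq_mul, mul_comm]

lemma ipw_pair {E α : Type*} [MeasurableSpace E] [MeasurableSpace α]
    (ν : Measure E) [IsProbabilityMeasure ν] (u v : E → α) (hu : Measurable u) (hv : Measurable v)
    (wu wv : E → ℝ) (hwu : Measurable wu) (hwv : Measurable wv) (M : ℝ)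
    (hwub : ∀ z, ‖wu z‖ ≤ M) (hwvb : ∀ z, ‖wv z‖ ≤ M)
    (Hu : ∀ h : α → ℝ, Measurable h → ∫ z, h (u z) * wu z ∂ν = ∫ z, h (u z) ∂ν)
    (Hv : ∀ h : α → ℝ, Measurable h → ∫ z, h (v z) * wv z ∂ν = ∫ z, h (v z) ∂ν)
    (k : α × α → ℝ) (hk : Measurable k) (C : ℝ) (hkb : ∀ p, ‖k p‖ ≤ C) :
    ∫ p, k (u p.1, v p.2) ∂(ν.prod ν)
      = ∫ p, k (u p.1, v p.2) * (wu p.1 * wv p.2) ∂(ν.prod ν) := by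
  have hm : Measurable (fun p : E × E => k (u p.1, v p.2)) := by fun_prop
  have I1 : Integrable (fun p : E × E => k (u p.1, v p.2)) (ν.prod ν) :=
    Integrable.of_bound hm.aestronglyMeasurable C (ae_of_all _ fun _ => hkb _)
  have hm2 : Measurable (fun p : E × E => wu p.1 * wv p.2) := by fun_prop
  have I2 : Integrable (fun p : E × E => k (u p.1, v p.2) * (wu p.1 * wv p.2)) (ν.prod ν) := by
    refine I1.mul_bdd (c := M * M) hm2.aestronglyMeasurable (ae_of_all _ fun p => ?_)
    rw [norm_mul]
    exact mul_le_mul (hwub _) (hwvb _) (norm_nonneg _) ((norm_nonneg _).trans (hwub p.1))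
  rw [integral_prod _ I1, integral_prod _ I2]
  have hH : Measurable (fun y : α => ∫ z, k (y, v z) ∂ν) := by
    have : StronglyMeasurable (fun p : α × E => k (p.1, v p.2)) :=
      Measurable.stronglyMeasurable (by fun_prop)
    exact this.integral_prod_right'.measurable
  rw [← Hu _ hH]
  congr 1
  ext z
  simp only
  rw [← Hv (fun y => k (u z, y)) (by fun_prop), ← integral_mul_const]
  congr 1
  ext z'
  ring

lemma ipw_single {Ω 𝒳 : Type*} [MeasurableSpace Ω] [StandardBorelSpace Ω]
    [MeasurableSpace 𝒳]
    (μ : Measure Ω) [IsProbabilityMeasure μ]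
    (Y1 Y0 : Ω → ℝ) (hY1 : Measurable Y1) (hY0 : Measurable Y0)
    (D : Ω → ℝ) (hD : Measurable D) (hDbin : ∀ ω, D ω = 0 ∨ D ω = 1)
    (X : Ω → 𝒳) (hX : Measurable X)
    (hCI : CondIndepFun (MeasurableSpace.comap X inferInstance) hX.comap_le
      (fun ω => (Y1 ω, Y0 ω)) D μ)
    (e : 𝒳 → ℝ) (he : Measurable e)
    (hecond : (fun ω => e (X ω)) =ᵐ[μ] μ[D | MeasurableSpace.comap X inferInstance])
    (κ : ℝ) (hκpos : 0 < κ)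
    (hoverlap : ∀ x, κ ≤ e x ∧ e x ≤ 1 - κ)
    (a : ℕ) (ha : a = 0 ∨ a = 1) (h : ℝ × 𝒳 → ℝ) (hh : Measurable h) :
    ∫ ω, h ((if a = 1 then Y1 ω else Y0 ω), X ω) * ((if D ω = (a : ℝ) then (1 : ℝ) else 0)
      / (if a = 1 then e (X ω) else 1 - e (X ω))) ∂μ
      = ∫ ω, h ((if a = 1 then Y1 ω else Y0 ω), X ω) ∂μ := by
  have hCI' := (condIndepFun_iff_condExp_inter_preimage_eq_mul (hY1.prodMk hY0) hD).1 hCI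
  have hDint : Integrable D μ := Integrable.of_bound hD.aestronglyMeasurable 1
    (ae_of_all _ fun ω => by rcases hDbin ω with h | h <;> simp [h])
  have hT : MeasurableSet (D ⁻¹' {(a : ℝ)}) := hD (measurableSet_singleton _)
  have main := ipw_core μ (fun ω => if a = 1 then Y1 ω else Y0 ω)
    (by split_ifs <;> assumption) X hX (D ⁻¹' {(a : ℝ)}) hT
    (fun x => if a = 1 then e x else 1 - e x)
    (by split_ifs; exacts [he, measurable_const.sub he]) κ hκpos
    (fun x => by have := hoverlap x; split_ifs <;> linarith) ?_ ?_ h hh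
  · rw [← main]
    congr 1
  · rcases ha with rfl | rfl
    · have e0 : (D ⁻¹' {((0 : ℕ) : ℝ)}).indicator (fun _ => (1 : ℝ)) = (fun _ => 1) - D := by
        ext ω
        rcases hDbin ω with h | h <;> simp [Set.indicator, h]
      rw [e0]
      filter_upwards [hecond, condExp_sub (integrable_const (1 : ℝ)) hDint
        (MeasurableSpace.comap X inferInstance)] with ω h1 h2
      rw [h2, Pi.sub_apply, ← h1, condExp_const hX.comap_le]
      simp
    · have e0 : (D ⁻¹' {((1 : ℕ) : ℝ)}).indicator (fun _ => (1 : ℝ)) = D := by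
        ext ω
        rcases hDbin ω with h | h <;> simp [Set.indicator, h]
      rw [e0]
      simpa using hecond
  · intro A hA
    rcases ha with rfl | rfl
    · exact hCI' (Prod.snd ⁻¹' A) _ (measurable_snd hA) (measurableSet_singleton _)
    · exact hCI' (Prod.fst ⁻¹' A) _ (measurable_fst hA) (measurableSet_singleton _)

/-- **IPW identification of pairwise (U-statistic) welfare under unconfoundedness.**
With an independent copy `(Y'(1), Y'(0), D', X')` of the data, for any `(a,b) ∈ {0,1}²`,
bounded measurable `g` and binary `π_ab`,
`E[g(Y(a),X,Y'(b),X') π_ab(X,X')]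
  = E[g(Y,X,Y',X') 1{D=a} 1{D'=b} π_ab(X,X') / (e_a(X) e_b(X'))]`. -/
theorem ipw_identification_pairs {Ω 𝒳 : Type*} [MeasurableSpace Ω] [StandardBorelSpace Ω]
    [Nonempty Ω] [MeasurableSpace 𝒳] [StandardBorelSpace 𝒳]
    (μ : Measure Ω) [IsProbabilityMeasure μ]
    (Y1 Y0 Y1' Y0' : Ω → ℝ)
    (hY1 : Measurable Y1) (hY0 : Measurable Y0)
    (hY1' : Measurable Y1') (hY0' : Measurable Y0')
    (hY1b : ∃ C, ∀ ω, |Y1 ω| ≤ C) (hY0b : ∃ C, ∀ ω, |Y0 ω| ≤ C)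
    (D D' : Ω → ℝ) (hD : Measurable D) (hD' : Measurable D')
    (hDbin : ∀ ω, D ω = 0 ∨ D ω = 1) (hDbin' : ∀ ω, D' ω = 0 ∨ D' ω = 1)
    (X X' : Ω → 𝒳) (hX : Measurable X) (hX' : Measurable X')
    -- `(Y'(1), Y'(0), D', X')` is an independent copy of `(Y(1), Y(0), D, X)`
    (hcopyIndep : IndepFun (fun ω => (Y1 ω, Y0 ω, D ω, X ω))
      (fun ω => (Y1' ω, Y0' ω, D' ω, X' ω)) μ)
    (hcopyId : IdentDistrib (fun ω => (Y1 ω, Y0 ω, D ω, X ω))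
      (fun ω => (Y1' ω, Y0' ω, D' ω, X' ω)) μ μ)
    -- (i) unconfoundedness: (Y(1), Y(0)) ⫫ D | σ(X)
    (hCI : CondIndepFun (MeasurableSpace.comap X inferInstance) hX.comap_le
      (fun ω => (Y1 ω, Y0 ω)) D μ)
    -- (ii) propensity score and overlap
    (e : 𝒳 → ℝ) (he : Measurable e)
    (hecond : (fun ω => e (X ω)) =ᵐ[μ] μ[D | MeasurableSpace.comap X inferInstance])
    (κ : ℝ) (hκpos : 0 < κ) (hκhalf : κ ≤ 1 / 2)
    (hoverlap : ∀ x, κ ≤ e x ∧ e x ≤ 1 - κ)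
    -- observed outcomes
    (Y Y' : Ω → ℝ) (hYobs : ∀ ω, Y ω = D ω * Y1 ω + (1 - D ω) * Y0 ω)
    (hYobs' : ∀ ω, Y' ω = D' ω * Y1' ω + (1 - D' ω) * Y0' ω)
    (a b : ℕ) (ha : a = 0 ∨ a = 1) (hb : b = 0 ∨ b = 1)
    (g : ℝ × 𝒳 × ℝ × 𝒳 → ℝ) (hg : Measurable g) (hgb : ∃ C, ∀ p, |g p| ≤ C)
    (π : 𝒳 × 𝒳 → ℝ) (hπ : Measurable π) (hπbin : ∀ p, π p = 0 ∨ π p = 1) :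
    (∫ ω, g ((if a = 1 then Y1 ω else Y0 ω), X ω,
        (if b = 1 then Y1' ω else Y0' ω), X' ω) * π (X ω, X' ω) ∂μ)
      = ∫ ω, g (Y ω, X ω, Y' ω, X' ω)
          * ((if D ω = (a : ℝ) then (1 : ℝ) else 0) * (if D' ω = (b : ℝ) then (1 : ℝ) else 0))
          * π (X ω, X' ω)
          / ((if a = 1 then e (X ω) else 1 - e (X ω))
              * (if b = 1 then e (X' ω) else 1 - e (X' ω))) ∂μ := by
  obtain ⟨C, hC⟩ := hgb
  set Z : Ω → ℝ × ℝ × ℝ × 𝒳 := fun ω => (Y1 ω, Y0 ω, D ω, X ω) with hZdef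
  set Z' : Ω → ℝ × ℝ × ℝ × 𝒳 := fun ω => (Y1' ω, Y0' ω, D' ω, X' ω) with hZdef'
  have hZ : Measurable Z := hY1.prodMk (hY0.prodMk (hD.prodMk hX))
  have hZ' : Measurable Z' := hY1'.prodMk (hY0'.prodMk (hD'.prodMk hX'))
  have hprod : μ.map (fun ω => (Z ω, Z' ω)) = (μ.map Z).prod (μ.map Z) := by
    rw [(indepFun_iff_map_prod_eq_prod_map_map hZ.aemeasurable hZ'.aemeasurable).1 hcopyIndep,
      ← hcopyId.map_eq]
  have hν : IsProbabilityMeasure (μ.map Z) := Measure.isProbabilityMeasure_map hZ.aemeasurable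
  let sel : ℕ → ℝ × ℝ × ℝ × 𝒳 → ℝ × 𝒳 := fun c z => ((if c = 1 then z.1 else z.2.1), z.2.2.2)
  let wt : ℕ → ℝ × ℝ × ℝ × 𝒳 → ℝ := fun c z => (if z.2.2.1 = (c : ℝ) then (1 : ℝ) else 0)
      / (if c = 1 then e z.2.2.2 else 1 - e z.2.2.2)
  have hsel : ∀ c, Measurable (sel c) := by
    intro c
    by_cases hc : c = 1 <;> simp only [sel, hc, if_true, if_false] <;> fun_prop
  have hwt : ∀ c, Measurable (wt c) := by
    intro c
    have h1 : Measurable (fun z : ℝ × ℝ × ℝ × 𝒳 => if z.2.2.1 = (c : ℝ) then (1 : ℝ) else 0) :=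
      Measurable.ite ((by fun_prop : Measurable (fun z : ℝ × ℝ × ℝ × 𝒳 => z.2.2.1))
        (measurableSet_singleton _)) measurable_const measurable_const
    refine h1.div ?_
    by_cases hc : c = 1 <;> simp only [hc, if_true, if_false] <;> fun_prop
  have hwtb : ∀ c z, ‖wt c z‖ ≤ 1 / κ := by
    intro c z
    have h0 : κ ≤ (if c = 1 then e z.2.2.2 else 1 - e z.2.2.2) := by
      have := hoverlap z.2.2.2
      split_ifs <;> linarith
    rw [Real.norm_of_nonneg (div_nonneg (by split_ifs <;> norm_num) (hκpos.le.trans h0))]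
    exact div_le_div₀ zero_le_one (by split_ifs <;> norm_num) hκpos h0
  have H : ∀ c : ℕ, (c = 0 ∨ c = 1) → ∀ h : ℝ × 𝒳 → ℝ, Measurable h →
      ∫ z, h (sel c z) * wt c z ∂(μ.map Z) = ∫ z, h (sel c z) ∂(μ.map Z) := by
    intro c hc h hh
    have m1 : Measurable (fun z => h (sel c z)) := hh.comp (hsel c)
    have m2 : Measurable (fun z => h (sel c z) * wt c z) := m1.mul (hwt c)
    rw [integral_map hZ.aemeasurable m2.aestronglyMeasurable,
      integral_map hZ.aemeasurable m1.aestronglyMeasurable]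
    exact ipw_single μ Y1 Y0 hY1 hY0 D hD hDbin X hX hCI e he hecond κ hκpos hoverlap c hc h hh
  let k : (ℝ × 𝒳) × (ℝ × 𝒳) → ℝ := fun p =>
    g (p.1.1, p.1.2, p.2.1, p.2.2) * π (p.1.2, p.2.2)
  have hk : Measurable k := by simp only [k]; fun_prop
  have hkb : ∀ p, ‖k p‖ ≤ C := by
    intro p
    have := hC (p.1.1, p.1.2, p.2.1, p.2.2)
    rcases hπbin (p.1.2, p.2.2) with h | h
    · simpa [k, h] using (abs_nonneg _).trans this
    · simpa [k, h] using this
  have P := ipw_pair (μ.map Z) (sel a) (sel b) (hsel a) (hsel b) (wt a) (wt b) (hwt a) (hwt b)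
    (1 / κ) (hwtb a) (hwtb b) (H a ha) (H b hb) k hk C hkb
  have hks : Measurable (fun p : (ℝ × ℝ × ℝ × 𝒳) × (ℝ × ℝ × ℝ × 𝒳) => k (sel a p.1, sel b p.2)) :=
    hk.comp (((hsel a).comp measurable_fst).prodMk ((hsel b).comp measurable_snd))
  have hks2 : Measurable (fun p : (ℝ × ℝ × ℝ × 𝒳) × (ℝ × ℝ × ℝ × 𝒳) =>
      k (sel a p.1, sel b p.2) * (wt a p.1 * wt b p.2)) :=
    hks.mul (((hwt a).comp measurable_fst).mul ((hwt b).comp measurable_snd))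
  rw [← hprod, integral_map (hZ.prodMk hZ').aemeasurable hks.aestronglyMeasurable,
    integral_map (hZ.prodMk hZ').aemeasurable hks2.aestronglyMeasurable] at P
  refine P.trans ?_
  congr 1
  ext ω
  have obs : ∀ (c : ℕ) (d y1 y0 : ℝ), (c = 0 ∨ c = 1) → d = (c : ℝ) →
      d * y1 + (1 - d) * y0 = if c = 1 then y1 else y0 := by
    rintro c d y1 y0 (rfl | rfl) rfl <;> simp
  simp only [k, sel, wt, hZdef, hZdef']
  by_cases h1 : D ω = (a : ℝ)
  · by_cases h2 : D' ω = (b : ℝ)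
    · rw [hYobs, hYobs', obs a _ _ _ ha h1, obs b _ _ _ hb h2]
      simp only [h1, h2, if_true]
      rw [div_mul_div_comm]
      ring
    · simp [h2]
  · simp [h1]
end

section
/- Let n ≥ 2, let (Z_1, …, Z_n) be i.i.d. random variables with law μ on a measurable space 𝒵, let F be a nonempty finite set of bounded measurable symmetric kernels h : 𝒵 × 𝒵 → ℝ, and let ε_1, …, ε_{⌊n/2⌋} be i.i.d. Rademacher random variables (taking values +1 and −1 with probability 1/2 each) independent of (Z_1, …, Z_n). Then E[ sup_{h ∈ F} | C(n,2)^{-1} Σ_{1 ≤ i < j ≤ n} ( h(Z_i, Z_j) − E[h(Z, Z')] ) | ] ≤ 2·E[ sup_{h ∈ F} | ⌊n/2⌋^{-1} Σ_{i=1}^{⌊n/2⌋} ε_i · h(Z_i, Z_{⌊n/2⌋ + i}) | ], where Z, Z' are independent with law μ and C(n,2) = n(n−1)/2. -/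
open MeasureTheory ProbabilityTheory Finset

/-- Integrability of a finite supremum of absolute values. -/
lemma integrable_supAbs {ι α : Type*} [MeasurableSpace α] {ν : Measure α}
    (F : Finset ι) (hF : F.Nonempty) (x : ι → α → ℝ) (hx : ∀ h ∈ F, Integrable (x h) ν) :
    Integrable (fun a => F.sup' hF (fun h => |x h a|)) ν := by
  have h1 : Integrable (F.sup' hF (fun h a => |x h a|)) ν :=
    Finset.sup'_induction (p := fun f => Integrable f ν) hF _
      (fun _ hf _ hg => hf.sup hg) (fun h hh => (hx h hh).abs)
  refine h1.congr (Filter.Eventually.of_forall fun a => ?_)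
  simp [Finset.sup'_apply]

lemma measurable_supAbs {ι α : Type*} [MeasurableSpace α]
    (F : Finset ι) (hF : F.Nonempty) (x : ι → α → ℝ) (hx : ∀ h ∈ F, Measurable (x h)) :
    Measurable (fun a => F.sup' hF (fun h => |x h a|)) := by
  have h1 : Measurable (F.sup' hF (fun h a => |x h a|)) :=
    Finset.measurable_sup' hF (fun h hh => (hx h hh).abs)
  convert h1 using 1
  ext a
  simp [Finset.sup'_apply]

/-- Swapping a fixed set of coordinates between two samples preserves the product law. -/
lemma measurePreserving_swap_coords {𝒵 : Type*} [MeasurableSpace 𝒵] (μ : Measure 𝒵)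
    [IsProbabilityMeasure μ] (n : ℕ) (d : Fin n → Prop) [DecidablePred d] :
    MeasurePreserving
      (fun p : (Fin n → 𝒵) × (Fin n → 𝒵) =>
        ((fun j => if d j then p.2 j else p.1 j, fun j => if d j then p.1 j else p.2 j) :
          (Fin n → 𝒵) × (Fin n → 𝒵)))
      ((Measure.pi fun _ => μ).prod (Measure.pi fun _ => μ))
      ((Measure.pi fun _ => μ).prod (Measure.pi fun _ => μ)) := by
  have e := measurePreserving_arrowProdEquivProdArrow 𝒵 𝒵 (Fin n) (fun _ => μ) (fun _ => μ)
  have hm : MeasurePreserving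
      (fun (a : Fin n → 𝒵 × 𝒵) i => (if d i then Prod.swap else id : 𝒵 × 𝒵 → 𝒵 × 𝒵) (a i))
      (Measure.pi fun _ => μ.prod μ) (Measure.pi fun _ => μ.prod μ) := by
    refine measurePreserving_pi (fun _ => μ.prod μ) (fun _ => μ.prod μ)
      (f := fun i => (if d i then Prod.swap else id : 𝒵 × 𝒵 → 𝒵 × 𝒵)) fun i => ?_
    split_ifs
    · exact Measure.measurePreserving_swap
    · exact MeasurePreserving.id _
  have := e.comp (hm.comp (e.symm _))
  convert this using 1
  ext p j
  · by_cases h : d j <;>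
      simp [MeasurableEquiv.arrowProdEquivProdArrow, Equiv.arrowProdEquivProdArrow, h]
  · by_cases h : d j <;>
      simp [MeasurableEquiv.arrowProdEquivProdArrow, Equiv.arrowProdEquivProdArrow, h]

/-- Permutation average does not depend on the pair. -/
lemma perm_sum_const (n : ℕ) (g : Fin n → Fin n → ℝ) (a b a' b' : Fin n) (hab : a ≠ b)
    (hab' : a' ≠ b') :
    ∑ σ : Equiv.Perm (Fin n), g (σ a) (σ b) = ∑ σ : Equiv.Perm (Fin n), g (σ a') (σ b') := by
  obtain ⟨τ, h1, h2⟩ : ∃ τ : Equiv.Perm (Fin n), τ a = a' ∧ τ b = b' := by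
    refine ⟨Equiv.swap (Equiv.swap a a' b) b' * Equiv.swap a a', ?_, ?_⟩
    · have : a' ≠ Equiv.swap a a' b := by
        intro h
        have h3 : Equiv.swap a a' a = Equiv.swap a a' b := by
          rw [Equiv.swap_apply_left]; exact h
        exact hab ((Equiv.swap a a').injective h3)
      simp only [Equiv.Perm.mul_apply, Equiv.swap_apply_left]
      exact Equiv.swap_apply_of_ne_of_ne this hab'
    · simp only [Equiv.Perm.mul_apply, Equiv.swap_apply_left]
  rw [← Equiv.sum_comp (Equiv.mulRight τ) (fun σ : Equiv.Perm (Fin n) => g (σ a) (σ b))]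
  simp [h1, h2]

lemma card_lt_pairs (n : ℕ) :
    (Finset.univ.filter (fun p : Fin n × Fin n => p.1 < p.2)).card = n.choose 2 := by
  have h1 := Finset.sum_range_id n
  rw [Finset.card_filter, Fintype.sum_prod_type_right, Nat.choose_two_right, ← h1,
    ← Fin.sum_univ_eq_sum_range]
  refine Finset.sum_congr rfl fun j _ => ?_
  rw [← Finset.card_filter]
  have : (Finset.univ.filter (fun x : Fin n => x < j)) = Finset.Iio j := by
    ext; simp
  rw [this, Fin.card_Iio]

lemma sum_lt_symm (n : ℕ) (g : Fin n → Fin n → ℝ) (hg : ∀ i j, g i j = g j i) :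
    ∑ p : Fin n × Fin n, (if p.1 ≠ p.2 then g p.1 p.2 else 0) =
      2 * ∑ p ∈ Finset.univ.filter (fun p : Fin n × Fin n => p.1 < p.2), g p.1 p.2 := by
  have h1 : ∀ p : Fin n × Fin n, (if p.1 ≠ p.2 then g p.1 p.2 else 0) =
      (if p.1 < p.2 then g p.1 p.2 else 0) + (if p.2 < p.1 then g p.1 p.2 else 0) := by
    intro p
    rcases lt_trichotomy p.1 p.2 with h | h | h
    · simp [h, h.ne, h.not_gt]
    · simp [h]
    · simp [h, h.ne', h.not_gt]
  have h2 : ∑ p : Fin n × Fin n, (if p.2 < p.1 then g p.1 p.2 else 0) =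
      ∑ p : Fin n × Fin n, (if p.1 < p.2 then g p.1 p.2 else 0) := by
    rw [← Equiv.sum_comp (Equiv.prodComm (Fin n) (Fin n))]
    refine Finset.sum_congr rfl fun p _ => ?_
    simp [hg p.2 p.1]
  simp_rw [h1]
  rw [Finset.sum_add_distrib, h2, Finset.sum_filter]
  ring

/-- Hoeffding's permutation representation, for a single pair. -/
lemma hoeffding_pair (n : ℕ) (g : Fin n → Fin n → ℝ) (hg : ∀ i j, g i j = g j i)
    (a b : Fin n) (hab : a ≠ b) :
    (n.choose 2 : ℝ) * ∑ σ : Equiv.Perm (Fin n), g (σ a) (σ b) =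
      (n.factorial : ℝ) *
        ∑ p ∈ Finset.univ.filter (fun p : Fin n × Fin n => p.1 < p.2), g p.1 p.2 := by
  have h1 : (n.choose 2 : ℝ) * ∑ σ : Equiv.Perm (Fin n), g (σ a) (σ b) =
      ∑ p ∈ Finset.univ.filter (fun p : Fin n × Fin n => p.1 < p.2),
        ∑ σ : Equiv.Perm (Fin n), g (σ p.1) (σ p.2) := by
    rw [← card_lt_pairs, ← nsmul_eq_mul, ← Finset.sum_const]
    refine Finset.sum_congr rfl fun p hp => ?_
    exact perm_sum_const n g a b p.1 p.2 hab (Finset.mem_filter.1 hp).2.ne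
  rw [h1, Finset.sum_comm]
  have h2 : ∀ σ : Equiv.Perm (Fin n),
      ∑ p ∈ Finset.univ.filter (fun p : Fin n × Fin n => p.1 < p.2), g (σ p.1) (σ p.2) =
      ∑ p ∈ Finset.univ.filter (fun p : Fin n × Fin n => p.1 < p.2), g p.1 p.2 := by
    intro σ
    have e1 := sum_lt_symm n g hg
    have e2 := sum_lt_symm n (fun i j => g (σ i) (σ j)) (fun i j => hg _ _)
    have e3 : ∑ p : Fin n × Fin n, (if p.1 ≠ p.2 then g (σ p.1) (σ p.2) else 0) =
        ∑ p : Fin n × Fin n, (if p.1 ≠ p.2 then g p.1 p.2 else 0) := by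
      rw [← Equiv.sum_comp (Equiv.prodCongr σ σ)
        (fun p : Fin n × Fin n => (if p.1 ≠ p.2 then g p.1 p.2 else 0))]
      refine Finset.sum_congr rfl fun p _ => ?_
      simp
    linarith
  simp_rw [h2]
  rw [Finset.sum_const, Finset.card_univ, Fintype.card_perm, Fintype.card_fin, nsmul_eq_mul]

/-- Hoeffding's permutation representation. -/
lemma hoeffding_rep (n m : ℕ) (hn : 2 ≤ n) (hm : 0 < m) (g : Fin n → Fin n → ℝ)
    (hg : ∀ i j, g i j = g j i) (a b : Fin m → Fin n) (hab : ∀ i, a i ≠ b i) :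
    (n.choose 2 : ℝ)⁻¹ *
        ∑ p ∈ Finset.univ.filter (fun p : Fin n × Fin n => p.1 < p.2), g p.1 p.2 =
      (n.factorial : ℝ)⁻¹ * ∑ σ : Equiv.Perm (Fin n),
        ((m : ℝ)⁻¹ * ∑ i, g (σ (a i)) (σ (b i))) := by
  have hc : (n.choose 2 : ℝ) ≠ 0 := by
    exact_mod_cast (Nat.choose_pos hn).ne'
  have hf : (n.factorial : ℝ) ≠ 0 := by exact_mod_cast n.factorial_ne_zero
  have hm' : (m : ℝ) ≠ 0 := by exact_mod_cast hm.ne'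
  rw [← Finset.mul_sum, Finset.sum_comm]
  have : ∀ i, ∑ σ : Equiv.Perm (Fin n), g (σ (a i)) (σ (b i)) =
      (n.choose 2 : ℝ)⁻¹ * ((n.factorial : ℝ) *
        ∑ p ∈ Finset.univ.filter (fun p : Fin n × Fin n => p.1 < p.2), g p.1 p.2) := by
    intro i
    rw [← hoeffding_pair n g hg (a i) (b i) (hab i)]
    field_simp
  simp_rw [this]
  rw [Finset.sum_const, Finset.card_univ, Fintype.card_fin, nsmul_eq_mul]
  field_simp

/-- Classical symmetrization on disjoint pairs, with a fixed vector of signs. -/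
lemma symm_pairs {𝒵 : Type*} [MeasurableSpace 𝒵] (μ : Measure 𝒵) [IsProbabilityMeasure μ]
    (n m : ℕ) (a b : Fin m → Fin n) (ha : Function.Injective a) (hb : Function.Injective b)
    (hab : ∀ i j, a i ≠ b j) (F : Finset (𝒵 → 𝒵 → ℝ)) (hF : F.Nonempty)
    (θ : (𝒵 → 𝒵 → ℝ) → ℝ)
    (hint : ∀ h ∈ F, ∀ i, Integrable (fun z : Fin n → 𝒵 => h (z (a i)) (z (b i)))
      (Measure.pi fun _ => μ))
    (hθ : ∀ h ∈ F, ∀ i, ∫ z : Fin n → 𝒵, h (z (a i)) (z (b i)) ∂(Measure.pi fun _ => μ) = θ h)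
    (c : ℝ) (s : Fin m → ℝ) (hs : ∀ i, s i = 1 ∨ s i = -1) :
    ∫ z : Fin n → 𝒵, F.sup' hF (fun h => |c * ∑ i, (h (z (a i)) (z (b i)) - θ h)|)
        ∂(Measure.pi fun _ => μ) ≤
      2 * ∫ z : Fin n → 𝒵, F.sup' hF (fun h => |c * ∑ i, s i * h (z (a i)) (z (b i))|)
        ∂(Measure.pi fun _ => μ) := by
  classical
  set ν : Measure (Fin n → 𝒵) := Measure.pi fun _ => μ with hν
  -- the ghost sample functional
  let G : (Fin n → 𝒵) × (Fin n → 𝒵) → ℝ := fun p =>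
    F.sup' hF (fun h => |c * ∑ i, (h (p.1 (a i)) (p.1 (b i)) - h (p.2 (a i)) (p.2 (b i)))|)
  let H : (Fin n → 𝒵) → ℝ := fun z =>
    F.sup' hF (fun h => |c * ∑ i, s i * h (z (a i)) (z (b i))|)
  have hGint : Integrable G (ν.prod ν) := by
    refine integrable_supAbs F hF (fun h (p : (Fin n → 𝒵) × (Fin n → 𝒵)) =>
      c * ∑ i, (h (p.1 (a i)) (p.1 (b i)) - h (p.2 (a i)) (p.2 (b i)))) fun h hh => ?_
    refine Integrable.const_mul (integrable_finsetSum _ fun i _ => ?_) _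
    exact ((hint h hh i).comp_fst ν).sub ((hint h hh i).comp_snd ν)
  have hHint : Integrable H ν := by
    refine integrable_supAbs F hF (fun h (z : Fin n → 𝒵) =>
      c * ∑ i, s i * h (z (a i)) (z (b i))) fun h hh => ?_
    exact Integrable.const_mul (integrable_finsetSum _ fun i _ => (hint h hh i).const_mul _) _
  have step1 : ∫ z, F.sup' hF (fun h => |c * ∑ i, (h (z (a i)) (z (b i)) - θ h)|) ∂ν ≤
      ∫ z, ∫ z', G (z, z') ∂ν ∂ν := by
    have hae : ∀ᵐ z ∂ν, Integrable (fun z' => G (z, z')) ν := hGint.prod_right_ae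
    refine integral_mono_ae ?_ hGint.integral_prod_left ?_
    · refine integrable_supAbs F hF (fun h (z : Fin n → 𝒵) =>
        c * ∑ i, (h (z (a i)) (z (b i)) - θ h)) fun h hh => ?_
      exact Integrable.const_mul
        (integrable_finsetSum _ fun i _ => (hint h hh i).sub (integrable_const _)) _
    · filter_upwards [hae] with z hz
      refine Finset.sup'_le hF _ fun h hh => ?_
      have hi : Integrable (fun z' : Fin n → 𝒵 =>
          c * ∑ i, (h (z (a i)) (z (b i)) - h (z' (a i)) (z' (b i)))) ν :=
        Integrable.const_mul
          (integrable_finsetSum _ fun i _ => (integrable_const _).sub (hint h hh i)) _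
      have heq : c * ∑ i, (h (z (a i)) (z (b i)) - θ h) =
          ∫ z', c * ∑ i, (h (z (a i)) (z (b i)) - h (z' (a i)) (z' (b i))) ∂ν := by
        have hi' : ∀ i ∈ (Finset.univ : Finset (Fin m)), Integrable (fun z' : Fin n → 𝒵 =>
            h (z (a i)) (z (b i)) - h (z' (a i)) (z' (b i))) ν :=
          fun i _ => (integrable_const _).sub (hint h hh i)
        rw [integral_const_mul, integral_finsetSum _ hi']
        congr 1
        refine Finset.sum_congr rfl fun i _ => ?_
        rw [integral_sub (integrable_const _) (hint h hh i), hθ h hh i]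
        simp
      rw [heq]
      refine (abs_integral_le_integral_abs).trans ?_
      refine integral_mono hi.abs hz fun z' => ?_
      exact Finset.le_sup' (fun h => |c * ∑ i, (h (z (a i)) (z (b i)) -
        h (z' (a i)) (z' (b i)))|) hh
  have step2 : ∫ z, ∫ z', G (z, z') ∂ν ∂ν = ∫ p, G p ∂(ν.prod ν) :=
    (integral_prod _ hGint).symm
  let d : Fin n → Prop := fun j => ∃ i, s i = -1 ∧ (j = a i ∨ j = b i)
  have hmp := measurePreserving_swap_coords μ n d
  set Φ := (fun p : (Fin n → 𝒵) × (Fin n → 𝒵) =>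
        ((fun j => if d j then p.2 j else p.1 j, fun j => if d j then p.1 j else p.2 j) :
          (Fin n → 𝒵) × (Fin n → 𝒵))) with hΦ
  have step3 : ∫ p, G p ∂(ν.prod ν) = ∫ p, G (Φ p) ∂(ν.prod ν) := by
    have h1 : AEStronglyMeasurable G (Measure.map Φ (ν.prod ν)) := by
      rw [hmp.map_eq]; exact hGint.aestronglyMeasurable
    rw [← integral_map hmp.measurable.aemeasurable h1, hmp.map_eq]
  have hda : ∀ i, d (a i) ↔ s i = -1 := by
    intro i
    constructor
    · rintro ⟨j, hj, h | h⟩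
      · rwa [ha h]
      · exact absurd h (hab i j)
    · intro h; exact ⟨i, h, Or.inl rfl⟩
  have hdb : ∀ i, d (b i) ↔ s i = -1 := by
    intro i
    constructor
    · rintro ⟨j, hj, h | h⟩
      · exact absurd h.symm (hab j i)
      · rwa [hb h]
    · intro h; exact ⟨i, h, Or.inr rfl⟩
  have hle : ∀ p, G (Φ p) ≤ H p.1 + H p.2 := by
    intro p
    refine Finset.sup'_le hF _ fun h hh => ?_
    have e : c * ∑ i, (h ((Φ p).1 (a i)) ((Φ p).1 (b i)) - h ((Φ p).2 (a i)) ((Φ p).2 (b i))) =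
        c * ∑ i, s i * h (p.1 (a i)) (p.1 (b i)) - c * ∑ i, s i * h (p.2 (a i)) (p.2 (b i)) := by
      rw [← mul_sub, ← Finset.sum_sub_distrib]
      congr 1
      refine Finset.sum_congr rfl fun i _ => ?_
      simp only [hΦ, hda, hdb]
      rcases hs i with h1 | h1
      · have : ¬ ((1 : ℝ) = -1) := by norm_num
        simp [h1, this]
      · simp [h1]
        ring
    rw [e]
    refine (abs_sub _ _).trans (add_le_add ?_ ?_)
    · exact Finset.le_sup' (fun h => |c * ∑ i, s i * h (p.1 (a i)) (p.1 (b i))|) hh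
    · exact Finset.le_sup' (fun h => |c * ∑ i, s i * h (p.2 (a i)) (p.2 (b i))|) hh
  have step4 : ∫ p, G (Φ p) ∂(ν.prod ν) ≤ 2 * ∫ z, H z ∂ν := by
    have hi1 : Integrable (fun p : (Fin n → 𝒵) × (Fin n → 𝒵) => H p.1) (ν.prod ν) :=
      hHint.comp_fst ν
    have hi2 : Integrable (fun p : (Fin n → 𝒵) × (Fin n → 𝒵) => H p.2) (ν.prod ν) :=
      hHint.comp_snd ν
    have hGΦ : Integrable (fun p => G (Φ p)) (ν.prod ν) := hmp.integrable_comp_of_integrable hGint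
    calc ∫ p, G (Φ p) ∂(ν.prod ν) ≤ ∫ p, (H p.1 + H p.2) ∂(ν.prod ν) :=
          integral_mono hGΦ (hi1.add hi2) hle
      _ = 2 * ∫ z, H z ∂ν := by
          rw [integral_add hi1 hi2, integral_fun_fst, integral_fun_snd]
          simp
          ring
  calc _ ≤ _ := step1
    _ = _ := step2
    _ = _ := step3
    _ ≤ _ := step4

/-- **Symmetrization for U-processes (Lemma 1).**
For i.i.d. `Z_1, …, Z_n` with law `μ`, a finite class `F` of bounded measurable symmetric
kernels, and i.i.d. Rademacher signs `ε_1, …, ε_{⌊n/2⌋}` independent of the data, the expected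
supremum of the centered U-statistic is bounded by twice the Rademacher complexity built on
the `⌊n/2⌋` disjoint pairs `(Z_i, Z_{⌊n/2⌋+i})`. -/
theorem u_process_symmetrization {Ω : Type*} {𝒵 : Type*}
    [MeasurableSpace Ω] [MeasurableSpace 𝒵]
    (P : Measure Ω) [IsProbabilityMeasure P] (μ : Measure 𝒵) [IsProbabilityMeasure μ]
    (n : ℕ) (hn : 2 ≤ n)
    (Z : Fin n → Ω → 𝒵) (hZmeas : ∀ i, Measurable (Z i))
    (hZlaw : ∀ i, Measure.map (Z i) P = μ)
    (ε : Fin (n / 2) → Ω → ℝ) (hεmeas : ∀ i, Measurable (ε i))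
    (hεval : ∀ i ω, ε i ω = 1 ∨ ε i ω = -1)
    (hεlaw : ∀ i, P {ω | ε i ω = 1} = 1 / 2 ∧ P {ω | ε i ω = -1} = 1 / 2)
    -- joint independence of all the `Z i` and all the `ε i`
    (hindep : iIndep
      (fun j : Fin n ⊕ Fin (n / 2) =>
        Sum.elim (fun i => MeasurableSpace.comap (Z i) inferInstance)
          (fun i => MeasurableSpace.comap (ε i) inferInstance) j) P)
    (F : Finset (𝒵 → 𝒵 → ℝ)) (hF : F.Nonempty)
    (hFbdd : ∀ h ∈ F, ∃ C, ∀ u v, |h u v| ≤ C)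
    (hFsymm : ∀ h ∈ F, ∀ u v, h u v = h v u)
    (hFmeas : ∀ h ∈ F, Measurable (fun p : 𝒵 × 𝒵 => h p.1 p.2)) :
    (∫ ω, F.sup' hF (fun h =>
        |((n.choose 2 : ℝ))⁻¹ *
          ∑ p ∈ Finset.univ.filter (fun p : Fin n × Fin n => p.1 < p.2),
            (h (Z p.1 ω) (Z p.2 ω) - ∫ q, h q.1 q.2 ∂(μ.prod μ))|) ∂P)
      ≤ 2 * ∫ ω, F.sup' hF (fun h =>
          |((n / 2 : ℕ) : ℝ)⁻¹ *
            ∑ i : Fin (n / 2),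
              ε i ω * h (Z ⟨i.val, by have := i.isLt; omega⟩ ω)
                (Z ⟨n / 2 + i.val, by have := i.isLt; omega⟩ ω)|) ∂P := by
  classical
  have hm : 0 < n / 2 := by omega
  let a : Fin (n / 2) → Fin n := fun i => ⟨i.val, by have := i.isLt; omega⟩
  let b : Fin (n / 2) → Fin n := fun i => ⟨n / 2 + i.val, by have := i.isLt; omega⟩
  have ha : Function.Injective a := by
    intro i j hij
    have := congrArg Fin.val hij
    exact Fin.ext this
  have hb : Function.Injective b := by
    intro i j hij
    have := congrArg Fin.val hij
    simp only [b] at this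
    exact Fin.ext (by omega)
  have hab : ∀ i j, a i ≠ b j := by
    intro i j hij
    have := congrArg Fin.val hij
    simp only [a, b] at this
    have := i.isLt
    omega
  let θ : (𝒵 → 𝒵 → ℝ) → ℝ := fun h => ∫ q, h q.1 q.2 ∂(μ.prod μ)
  set ν : Measure (Fin n → 𝒵) := Measure.pi fun _ => μ with hν
  -- independence facts
  have hZ : iIndepFun Z P := by
    rw [iIndepFun_iff_iIndep]
    exact hindep.precomp (g := Sum.inl) Sum.inl_injective
  let V : Ω → Fin n → 𝒵 := fun ω i => Z i ω
  let E : Ω → Fin (n / 2) → ℝ := fun ω i => ε i ω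
  have hVm : Measurable V := measurable_pi_lambda _ hZmeas
  have hEm : Measurable E := measurable_pi_lambda _ hεmeas
  have hV : Measure.map V P = ν := by
    have := (iIndepFun_iff_map_fun_eq_pi_map (fun i => (hZmeas i).aemeasurable)).1 hZ
    simpa [hZlaw] using this
  have hperm : ∀ σ : Equiv.Perm (Fin n),
      Measure.map (fun z : Fin n → 𝒵 => fun i => z (σ i)) ν = ν := by
    intro σ
    have h1 := (iIndepFun_iff_map_fun_eq_pi_map (fun i => (hZmeas (σ i)).aemeasurable)).1
      (hZ.precomp σ.injective)
    rw [← hV, Measure.map_map (by fun_prop) hVm, hV]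
    simp only [hZlaw] at h1
    exact h1
  have hEV : IndepFun E V P := by
    have h1 := indep_iSup_of_disjoint (m := fun j : Fin n ⊕ Fin (n / 2) =>
        Sum.elim (fun i => MeasurableSpace.comap (Z i) inferInstance)
          (fun i => MeasurableSpace.comap (ε i) inferInstance) j)
      (S := Set.range Sum.inr) (T := Set.range Sum.inl)
      (by
        rintro (i | i)
        · exact (hZmeas i).comap_le
        · exact (hεmeas i).comap_le) hindep
      (by
        rw [Set.disjoint_left]
        rintro _ ⟨i, rfl⟩ ⟨j, hj⟩
        cases hj)
    rw [IndepFun_iff_Indep]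
    simp only [iSup_range, Sum.elim_inl, Sum.elim_inr] at h1
    have e1 : MeasurableSpace.comap E inferInstance =
        ⨆ i, MeasurableSpace.comap (ε i) inferInstance := by
      simp only [MeasurableSpace.pi, MeasurableSpace.comap_iSup, MeasurableSpace.comap_comp]
      rfl
    have e2 : MeasurableSpace.comap V inferInstance =
        ⨆ i, MeasurableSpace.comap (Z i) inferInstance := by
      simp only [MeasurableSpace.pi, MeasurableSpace.comap_iSup, MeasurableSpace.comap_comp]
      rfl
    rw [e1, e2]
    exact h1
  have hjoint := (indepFun_iff_map_prod_eq_prod_map_map hEm.aemeasurable hVm.aemeasurable).1 hEV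
  rw [hV] at hjoint
  -- measurability and integrability of the kernels
  have hkm : ∀ h ∈ F, ∀ i j : Fin n, Measurable (fun z : Fin n → 𝒵 => h (z i) (z j)) := by
    intro h hh i j
    have h2 : Measurable (fun z : Fin n → 𝒵 => (z i, z j)) := by fun_prop
    exact (hFmeas h hh).comp h2
  have hki : ∀ h ∈ F, ∀ i j : Fin n, Integrable (fun z : Fin n → 𝒵 => h (z i) (z j)) ν := by
    intro h hh i j
    obtain ⟨C, hC⟩ := hFbdd h hh
    exact Integrable.of_bound (hkm h hh i j).aestronglyMeasurable C
      (Filter.Eventually.of_forall fun z => hC _ _)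
  have hθ : ∀ h ∈ F, ∀ i, ∫ z : Fin n → 𝒵, h (z (a i)) (z (b i)) ∂ν = θ h := by
    intro h hh i
    have h1 := (indepFun_iff_map_prod_eq_prod_map_map (hZmeas (a i)).aemeasurable
      (hZmeas (b i)).aemeasurable).1 (hZ.indepFun (hab i i))
    rw [hZlaw, hZlaw] at h1
    rw [← hV, integral_map hVm.aemeasurable (hkm h hh _ _).aestronglyMeasurable]
    simp only [θ]
    rw [← h1, integral_map ((hZmeas _).prodMk (hZmeas _)).aemeasurable
      (hFmeas h hh).aestronglyMeasurable]
  -- the functional of disjoint pairs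
  let T : (Fin n → 𝒵) → ℝ := fun z =>
    F.sup' hF (fun h => |((n / 2 : ℕ) : ℝ)⁻¹ * ∑ i, (h (z (a i)) (z (b i)) - θ h)|)
  have hTm : Measurable T := by
    refine measurable_supAbs F hF (fun h (z : Fin n → 𝒵) =>
      ((n / 2 : ℕ) : ℝ)⁻¹ * ∑ i, (h (z (a i)) (z (b i)) - θ h)) fun h hh => ?_
    exact (Finset.measurable_sum _ fun i _ =>
      (hkm h hh (a i) (b i)).sub measurable_const).const_mul _
  have hTi : Integrable T ν := by
    refine integrable_supAbs F hF (fun h (z : Fin n → 𝒵) =>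
      ((n / 2 : ℕ) : ℝ)⁻¹ * ∑ i, (h (z (a i)) (z (b i)) - θ h)) fun h hh => ?_
    exact Integrable.const_mul (integrable_finsetSum _ fun i _ =>
      (hki h hh (a i) (b i)).sub (integrable_const _)) _
  let L : (Fin n → 𝒵) → ℝ := fun z => F.sup' hF (fun h =>
        |((n.choose 2 : ℝ))⁻¹ *
          ∑ p ∈ Finset.univ.filter (fun p : Fin n × Fin n => p.1 < p.2),
            (h (z p.1) (z p.2) - θ h)|)
  have hLm : Measurable L := by
    refine measurable_supAbs F hF (fun h (z : Fin n → 𝒵) => ((n.choose 2 : ℝ))⁻¹ *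
          ∑ p ∈ Finset.univ.filter (fun p : Fin n × Fin n => p.1 < p.2),
            (h (z p.1) (z p.2) - θ h)) fun h hh => ?_
    exact (Finset.measurable_sum _ fun i _ =>
      (hkm h hh _ _).sub measurable_const).const_mul _
  have hLi : Integrable L ν := by
    refine integrable_supAbs F hF (fun h (z : Fin n → 𝒵) => ((n.choose 2 : ℝ))⁻¹ *
          ∑ p ∈ Finset.univ.filter (fun p : Fin n × Fin n => p.1 < p.2),
            (h (z p.1) (z p.2) - θ h)) fun h hh => ?_
    exact Integrable.const_mul (integrable_finsetSum _ fun i _ =>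
      (hki h hh _ _).sub (integrable_const _)) _
  have hfpos : (0 : ℝ) < (n.factorial : ℝ) := by exact_mod_cast n.factorial_pos
  have hLT : ∀ z, L z ≤ (n.factorial : ℝ)⁻¹ *
      ∑ σ : Equiv.Perm (Fin n), T (fun i => z (σ i)) := by
    intro z
    refine Finset.sup'_le hF _ fun h hh => ?_
    rw [hoeffding_rep n (n / 2) hn hm (fun i j => h (z i) (z j) - θ h)
      (fun i j => by rw [hFsymm h hh]) a b (fun i => hab i i), abs_mul,
      abs_of_pos (inv_pos.2 hfpos)]
    refine mul_le_mul_of_nonneg_left ?_ (inv_pos.2 hfpos).le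
    refine (Finset.abs_sum_le_sum_abs _ _).trans (Finset.sum_le_sum fun σ _ => ?_)
    exact Finset.le_sup' (fun h => |((n / 2 : ℕ) : ℝ)⁻¹ *
      ∑ i, (h (z (σ (a i))) (z (σ (b i))) - θ h)|) hh
  have hσm : ∀ σ : Equiv.Perm (Fin n),
      Measurable (fun z : Fin n → 𝒵 => fun i => z (σ i)) := fun σ => by fun_prop
  have hTσ : ∀ σ : Equiv.Perm (Fin n),
      ∫ z, T (fun i => z (σ i)) ∂ν = ∫ z, T z ∂ν := by
    intro σ
    rw [← integral_map (f := T) (hσm σ).aemeasurable hTm.aestronglyMeasurable, hperm σ]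
  have hTσi : ∀ σ : Equiv.Perm (Fin n), Integrable (fun z => T (fun i => z (σ i))) ν := by
    intro σ
    have : Integrable T (Measure.map (fun z : Fin n → 𝒵 => fun i => z (σ i)) ν) := by
      rw [hperm σ]; exact hTi
    exact this.comp_measurable (hσm σ)
  have hstep1 : ∫ z, L z ∂ν ≤ ∫ z, T z ∂ν := by
    calc ∫ z, L z ∂ν ≤ ∫ z, (n.factorial : ℝ)⁻¹ *
          ∑ σ : Equiv.Perm (Fin n), T (fun i => z (σ i)) ∂ν :=
          integral_mono hLi ((integrable_finsetSum _ fun σ _ => hTσi σ).const_mul _) hLT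
      _ = ∫ z, T z ∂ν := by
          rw [integral_const_mul, integral_finsetSum _ (fun σ _ => hTσi σ)]
          simp_rw [hTσ]
          rw [Finset.sum_const, Finset.card_univ, Fintype.card_perm, Fintype.card_fin,
            nsmul_eq_mul]
          field_simp
  -- the symmetrized functional
  let R : (Fin (n / 2) → ℝ) × (Fin n → 𝒵) → ℝ := fun p => F.sup' hF (fun h =>
    |((n / 2 : ℕ) : ℝ)⁻¹ * ∑ i, p.1 i * h (p.2 (a i)) (p.2 (b i))|)
  have hRm : Measurable R := by
    refine measurable_supAbs F hF (fun h (p : (Fin (n / 2) → ℝ) × (Fin n → 𝒵)) =>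
      ((n / 2 : ℕ) : ℝ)⁻¹ * ∑ i, p.1 i * h (p.2 (a i)) (p.2 (b i))) fun h hh => ?_
    exact (Finset.measurable_sum _ fun i _ =>
      ((measurable_pi_apply i).comp measurable_fst).mul
        ((hkm h hh (a i) (b i)).comp measurable_snd)).const_mul _
  have hRi : Integrable (fun ω => R (E ω, V ω)) P := by
    refine integrable_supAbs F hF (fun h (ω : Ω) =>
      ((n / 2 : ℕ) : ℝ)⁻¹ * ∑ i, E ω i * h (V ω (a i)) (V ω (b i))) fun h hh => ?_
    refine Integrable.const_mul (integrable_finsetSum _ fun i _ => ?_) _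
    obtain ⟨C, hC⟩ := hFbdd h hh
    refine Integrable.of_bound (((hεmeas i).mul
      ((hkm h hh (a i) (b i)).comp hVm)).aestronglyMeasurable) C
      (Filter.Eventually.of_forall fun ω => ?_)
    have h1 : |ε i ω| = 1 := by
      rcases hεval i ω with h | h <;> simp [h]
    rw [Real.norm_eq_abs, abs_mul]
    change |ε i ω| * _ ≤ C
    rw [h1, one_mul]
    exact hC _ _
  have hRi' : Integrable R ((Measure.map E P).prod ν) := by
    rw [← hjoint, integrable_map_measure hRm.aestronglyMeasurable
      (hEm.prodMk hVm).aemeasurable]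
    exact hRi
  have hReq : ∫ ω, R (E ω, V ω) ∂P = ∫ ω, ∫ z, R (E ω, z) ∂ν ∂P := by
    rw [← integral_map (f := R) (hEm.prodMk hVm).aemeasurable hRm.aestronglyMeasurable, hjoint,
      integral_prod _ hRi',
      integral_map hEm.aemeasurable hRi'.integral_prod_left.aestronglyMeasurable]
  have hRii : Integrable (fun ω => ∫ z, R (E ω, z) ∂ν) P :=
    hRi'.integral_prod_left.comp_measurable hEm
  have hstep2 : ∀ ω, ∫ z, T z ∂ν ≤ 2 * ∫ z, R (E ω, z) ∂ν := fun ω =>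
    symm_pairs μ n (n / 2) a b ha hb hab F hF θ (fun h hh i => hki h hh _ _) hθ _ (E ω)
      (fun i => hεval i ω)
  have hstep3 : ∫ z, T z ∂ν ≤ 2 * ∫ ω, R (E ω, V ω) ∂P := by
    rw [hReq, ← integral_const_mul]
    calc ∫ z, T z ∂ν = ∫ _ω : Ω, (∫ z, T z ∂ν) ∂P := by simp
      _ ≤ _ := integral_mono (integrable_const _) (hRii.const_mul _) hstep2
  have hL : ∫ ω, L (V ω) ∂P = ∫ z, L z ∂ν := by
    rw [← hV, integral_map hVm.aemeasurable hLm.aestronglyMeasurable]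
  calc _ = ∫ ω, L (V ω) ∂P := rfl
    _ = _ := hL
    _ ≤ _ := hstep1
    _ ≤ _ := hstep3
end

section
/- Let T be a set and F a nonempty finite set of functions T → {0,1}. Fix points t_1, …, t_n ∈ T and weights w_1, …, w_n ≥ 0 with Σ_i w_i > 0, and define the pseudometric D(f, g) = sqrt( Σ_i w_i·(f(t_i) − g(t_i))² / Σ_i w_i ) on F. Let ε > 0 and suppose N ≥ 1 is such that for every m ≥ 1 and every sequence s_1, …, s_m ∈ T there exists a subset G ⊆ F with |G| ≤ N such that every f ∈ F satisfies m^{-1} Σ_{j=1}^m 1{f(s_j) ≠ g(s_j)} ≤ ε² for some g ∈ G (i.e. N is an upper bound on all sample Hamming ε²-internal covering numbers of F). Then there exists a subset G ⊆ F with |G| ≤ N such that every f ∈ F satisfies D(f, g) ≤ ε for some g ∈ G. -/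
open Finset

/-- **Weighted-ℓ² covering numbers bounded by Hamming covering numbers (Online Appendix Lemma 1).**
If `N` bounds all sample Hamming `ε²`-internal covering numbers of a finite class `F` of binary
functions, then `F` admits an internal `ε`-cover of cardinality at most `N` under the weighted
empirical ℓ² pseudometric `D`. -/
theorem weighted_cover_from_hamming {T : Type*}
    (F : Finset (T → ℝ)) (hF : F.Nonempty)
    (hbin : ∀ f ∈ F, ∀ x : T, f x = 0 ∨ f x = 1)
    (n : ℕ) (t : Fin n → T) (w : Fin n → ℝ)
    (hw : ∀ i, 0 ≤ w i) (hwpos : 0 < ∑ i, w i)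
    (ε : ℝ) (hε : 0 < ε)
    (N : ℕ) (hN : 1 ≤ N)
    (hHam : ∀ m : ℕ, 1 ≤ m → ∀ s : Fin m → T,
      ∃ G : Finset (T → ℝ), G ⊆ F ∧ G.card ≤ N ∧
        ∀ f ∈ F, ∃ g ∈ G,
          (m : ℝ)⁻¹ * ∑ j, (if f (s j) ≠ g (s j) then (1 : ℝ) else 0) ≤ ε ^ 2) :
    ∃ G : Finset (T → ℝ), G ⊆ F ∧ G.card ≤ N ∧
      ∀ f ∈ F, ∃ g ∈ G,
        Real.sqrt ((∑ i, w i * (f (t i) - g (t i)) ^ 2) / ∑ i, w i) ≤ ε := by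
  classical
  set W := ∑ i, w i with hW
  let c : ℕ → Fin n → ℕ := fun k i => ⌈w i * (k : ℝ)⌉₊
  let I : (T → ℝ) → (T → ℝ) → T → ℝ := fun f g x => if f x ≠ g x then (1 : ℝ) else 0
  have hc : ∀ i, Filter.Tendsto (fun k : ℕ => (c k i : ℝ) / (k : ℝ)) Filter.atTop (nhds (w i)) :=
    fun i => (tendsto_nat_ceil_mul_div_atTop (hw i)).comp
      (tendsto_natCast_atTop_atTop (R := ℝ))
  have hlim : ∀ f g : T → ℝ, Filter.Tendsto
      (fun k : ℕ => (∑ i, (c k i : ℝ) * I f g (t i)) / ∑ i, (c k i : ℝ)) Filter.atTop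
      (nhds ((∑ i, w i * I f g (t i)) / W)) := by
    intro f g
    have h1 : Filter.Tendsto (fun k : ℕ => ∑ i, ((c k i : ℝ) / (k : ℝ)) * I f g (t i))
        Filter.atTop (nhds (∑ i, w i * I f g (t i))) :=
      tendsto_finsetSum _ fun i _ => (hc i).mul_const _
    have h2 : Filter.Tendsto (fun k : ℕ => ∑ i, ((c k i : ℝ) / (k : ℝ)))
        Filter.atTop (nhds W) :=
      tendsto_finsetSum _ fun i _ => hc i
    refine (h1.div h2 hwpos.ne').congr' ?_
    filter_upwards [Filter.eventually_ge_atTop 1] with k hk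
    have hk' : (k : ℝ) ≠ 0 := by positivity
    have e1 : ∑ i, ((c k i : ℝ) / (k : ℝ)) * I f g (t i)
        = (∑ i, (c k i : ℝ) * I f g (t i)) / k := by
      rw [Finset.sum_div]
      exact Finset.sum_congr rfl fun i _ => by ring
    simp only [Pi.div_apply]
    rw [e1, ← Finset.sum_div, div_div_div_cancel_right₀ hk']
  have hev : ∀ᶠ k : ℕ in Filter.atTop, ∀ p ∈ F ×ˢ F,
      ε ^ 2 < (∑ i, w i * I p.1 p.2 (t i)) / W →
      ε ^ 2 < (∑ i, (c k i : ℝ) * I p.1 p.2 (t i)) / ∑ i, (c k i : ℝ) := by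
    rw [Filter.eventually_all_finset]
    intro p _
    by_cases h : ε ^ 2 < (∑ i, w i * I p.1 p.2 (t i)) / W
    · filter_upwards [(hlim p.1 p.2).eventually_const_lt h] with k hk _ using hk
    · exact Filter.Eventually.of_forall fun k h' => absurd h' h
  obtain ⟨k, hk, hk1⟩ := (hev.and (Filter.eventually_ge_atTop 1)).exists
  have hm : 1 ≤ ∑ i, c k i := by
    have h1 : W * k ≤ ((∑ i, c k i : ℕ) : ℝ) := by
      push_cast
      rw [hW, Finset.sum_mul]
      exact Finset.sum_le_sum fun i _ => Nat.le_ceil _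
    have h2 : 0 < W * k := mul_pos hwpos (by exact_mod_cast hk1)
    have h3 : (0 : ℝ) < ((∑ i, c k i : ℕ) : ℝ) := lt_of_lt_of_le h2 h1
    exact_mod_cast h3
  obtain ⟨G, hGF, hGN, hG⟩ := hHam _ hm
    (fun j => t ((finSigmaFinEquiv (n := c k)).symm j).1)
  refine ⟨G, hGF, hGN, fun f hf => ?_⟩
  obtain ⟨g, hg, hfg⟩ := hG f hf
  refine ⟨g, hg, ?_⟩
  have hsum : ∑ j : Fin (∑ i, c k i), I f g (t ((finSigmaFinEquiv (n := c k)).symm j).1)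
      = ∑ i, (c k i : ℝ) * I f g (t i) := by
    rw [Equiv.sum_comp (finSigmaFinEquiv (n := c k)).symm (fun x => I f g (t x.1)),
      Fintype.sum_sigma]
    simp
  have hle : (∑ i, w i * I f g (t i)) / W ≤ ε ^ 2 := by
    by_contra hcon
    have := hk (f, g) (Finset.mem_product.2 ⟨hf, hGF hg⟩) (not_le.1 hcon)
    refine absurd this (not_lt.2 ?_)
    change (∑ i, (c k i : ℝ) * I f g (t i)) / ∑ i, (c k i : ℝ) ≤ ε ^ 2
    rw [← hsum, div_eq_inv_mul]
    have e : (∑ i, (c k i : ℝ)) = ((∑ i, c k i : ℕ) : ℝ) := by push_cast; rfl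
    rw [e]
    exact hfg
  have hsq : ∑ i, w i * (f (t i) - g (t i)) ^ 2 = ∑ i, w i * I f g (t i) := by
    refine Finset.sum_congr rfl fun i _ => ?_
    rcases hbin f hf (t i) with h1 | h1 <;> rcases hbin g (hGF hg) (t i) with h2 | h2 <;>
      simp [I, h1, h2]
  rw [hsq]
  exact Real.sqrt_le_iff.2 ⟨hε.le, hle⟩
end
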